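/- arXiv:2512.12335 — 2 statements merged into one kernel-verified Lean document; each statement's English description precedes it below -/
import Mathlib

section
/- For every E-linear code C of length n: the left dual C^{⊥L} is free; if C ≠ {0} then the right dual C^{⊥R} is not free; and the dual C^⊥ is free if and only if C is free. -/
open scoped BigOperators

/-- The non-unital ring `E` of order 4: the pair `(u, v)` represents `uκ + vζ`,
where `ζ = κ + τ`.  Multiplication: `(uκ + vζ)·(u'κ + v'ζ) = u'·(uκ + vζ)`. -/
def RingE : Type := ZMod 2 × ZMod 2

namespace RingE

instance : AddCommGroup RingE := inferInstanceAs (AddCommGroup (ZMod 2 × ZMod 2))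

instance : Mul RingE := ⟨fun a b => Prod.mk (Prod.fst a * Prod.fst b) (Prod.snd a * Prod.fst b)⟩

noncomputable instance : DecidableEq RingE := Classical.decEq _

instance : NonUnitalRing RingE where
  left_distrib a b c := by
    show Prod.mk (Prod.fst a * (Prod.fst b + Prod.fst c))
        (Prod.snd a * (Prod.fst b + Prod.fst c)) = _
    show _ = Prod.mk (Prod.fst a * Prod.fst b + Prod.fst a * Prod.fst c)
        (Prod.snd a * Prod.fst b + Prod.snd a * Prod.fst c)
    simp [mul_add]
  right_distrib a b c := by
    show Prod.mk ((Prod.fst a + Prod.fst b) * Prod.fst c)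
        ((Prod.snd a + Prod.snd b) * Prod.fst c) = _
    show _ = Prod.mk (Prod.fst a * Prod.fst c + Prod.fst b * Prod.fst c)
        (Prod.snd a * Prod.fst c + Prod.snd b * Prod.fst c)
    simp [add_mul]
  zero_mul a := by
    show Prod.mk ((0 : ZMod 2) * Prod.fst a) ((0 : ZMod 2) * Prod.fst a) = ((0 : ZMod 2), (0 : ZMod 2))
    simp
  mul_zero a := by
    show Prod.mk (Prod.fst a * (0 : ZMod 2)) (Prod.snd a * (0 : ZMod 2)) = ((0 : ZMod 2), (0 : ZMod 2))
    simp
  mul_assoc a b c := by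
    show Prod.mk (Prod.fst a * Prod.fst b * Prod.fst c) (Prod.snd a * Prod.fst b * Prod.fst c)
      = Prod.mk (Prod.fst a * (Prod.fst b * Prod.fst c)) (Prod.snd a * (Prod.fst b * Prod.fst c))
    simp [mul_assoc]

/-- The generator `κ`. -/
def kappa : RingE := Prod.mk 1 0

/-- The generator `τ`. -/
def tau : RingE := Prod.mk 1 1

/-- `ζ = κ + τ`. -/
def zeta : RingE := Prod.mk 0 1

/-- The reduction map `π : E → F₂`, sending `uκ + vζ` to `u`. -/
def pi (a : RingE) : ZMod 2 := Prod.fst a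

/-- `κ·c` for a scalar `c ∈ F₂`, i.e. the element `cκ` of `E`. -/
def kappaSMul (c : ZMod 2) : RingE := Prod.mk c 0

/-- `ζ·c` for a scalar `c ∈ F₂`, i.e. the element `cζ` of `E`. -/
def zetaSMul (c : ZMod 2) : RingE := Prod.mk 0 c

end RingE

namespace ECode

/-- Componentwise reduction `π : Eⁿ → F₂ⁿ`. -/
def piVec {n : ℕ} (x : Fin n → RingE) : Fin n → ZMod 2 := fun i => RingE.pi (x i)

/-- The vector `κv ∈ Eⁿ` attached to `v ∈ F₂ⁿ`. -/
def kappaVec {n : ℕ} (v : Fin n → ZMod 2) : Fin n → RingE := fun i => RingE.kappaSMul (v i)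

/-- The vector `ζv ∈ Eⁿ` attached to `v ∈ F₂ⁿ`. -/
def zetaVec {n : ℕ} (v : Fin n → ZMod 2) : Fin n → RingE := fun i => RingE.zetaSMul (v i)

/-- An `E`-linear code of length `n`: a left `E`-submodule of `Eⁿ`, i.e. an additive
subgroup closed under componentwise left multiplication by elements of `E`. -/
def IsECode {n : ℕ} (C : Set (Fin n → RingE)) : Prop :=
  (0 : Fin n → RingE) ∈ C ∧ (∀ x ∈ C, ∀ y ∈ C, x + y ∈ C) ∧ (∀ x ∈ C, -x ∈ C) ∧
    ∀ (a : RingE), ∀ x ∈ C, (fun i => a * x i) ∈ C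

/-- The residue code `C_Res = π(C)`. -/
def Res {n : ℕ} (C : Set (Fin n → RingE)) : Set (Fin n → ZMod 2) := piVec '' C

/-- The torsion code `C_Tor = {v ∈ F₂ⁿ : ζv ∈ C}`. -/
def Tor {n : ℕ} (C : Set (Fin n → RingE)) : Set (Fin n → ZMod 2) := {v | zetaVec v ∈ C}

/-- A code is free if its residue and torsion codes coincide. -/
def IsFree {n : ℕ} (C : Set (Fin n → RingE)) : Prop := Res C = Tor C

/-- The inner product on `Eⁿ`. -/
def Einner {n : ℕ} (w z : Fin n → RingE) : RingE := ∑ i, w i * z i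

/-- The left dual `C^{⊥L}`. -/
def dualL {n : ℕ} (C : Set (Fin n → RingE)) : Set (Fin n → RingE) :=
  {z | ∀ w ∈ C, Einner z w = 0}

/-- The right dual `C^{⊥R}`. -/
def dualR {n : ℕ} (C : Set (Fin n → RingE)) : Set (Fin n → RingE) :=
  {z | ∀ w ∈ C, Einner w z = 0}

/-- The (two-sided) dual `C^⊥ = C^{⊥L} ∩ C^{⊥R}`. -/
def dualE {n : ℕ} (C : Set (Fin n → RingE)) : Set (Fin n → RingE) := dualL C ∩ dualR C

/-- The left hull `LHull(C) = C ∩ C^{⊥L}`. -/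
def LHull {n : ℕ} (C : Set (Fin n → RingE)) : Set (Fin n → RingE) := C ∩ dualL C

/-- The right hull `RHull(C) = C ∩ C^{⊥R}`. -/
def RHull {n : ℕ} (C : Set (Fin n → RingE)) : Set (Fin n → RingE) := C ∩ dualR C

/-- The hull `Hull(C) = C ∩ C^⊥`. -/
def EHull {n : ℕ} (C : Set (Fin n → RingE)) : Set (Fin n → RingE) := C ∩ dualE C

/-- The Euclidean inner product on `F₂ⁿ`. -/
def Finner {n : ℕ} (w z : Fin n → ZMod 2) : ZMod 2 := ∑ i, w i * z i

/-- The Euclidean dual of an `F₂`-linear code. -/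
def dualF {n : ℕ} (B : Set (Fin n → ZMod 2)) : Set (Fin n → ZMod 2) :=
  {z | ∀ w ∈ B, Finner w z = 0}

/-- The hull of an `F₂`-linear code. -/
def FHull {n : ℕ} (B : Set (Fin n → ZMod 2)) : Set (Fin n → ZMod 2) := B ∩ dualF B

/-- `F₂`-dimension of an `F₂`-linear code (as the dimension of its span). -/
noncomputable def dimF {n : ℕ} (B : Set (Fin n → ZMod 2)) : ℕ :=
  Module.finrank (ZMod 2) (Submodule.span (ZMod 2) B)

/-- Scalar multiplication of a vector of `Eⁿ` by `a ∈ E`. -/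
def smulVec {n : ℕ} (a : RingE) (x : Fin n → RingE) : Fin n → RingE := fun i => a * x i

/-- The left `E`-span `⟨X⟩_E` of a finite set `X ⊆ Eⁿ`. -/
def spanE {n : ℕ} (X : Finset (Fin n → RingE)) : Set (Fin n → RingE) :=
  {y | ∃ c : (Fin n → RingE) → RingE, y = ∑ x ∈ X, smulVec (c x) x}

/-- The additive (`F₂`-) span `⟨X⟩_{F₂}` of a finite set `X ⊆ Eⁿ`: all sums of subsets. -/
def spanF {n : ℕ} (X : Finset (Fin n → RingE)) : Set (Fin n → RingE) :=
  {y | ∃ S : Finset (Fin n → RingE), S ⊆ X ∧ y = ∑ x ∈ S, x}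

/-- `X` is a generating set of the code `D` if `⟨X⟩_E ∪ ⟨X⟩_{F₂} = D`. -/
def IsGenSet {n : ℕ} (X : Finset (Fin n → RingE)) (D : Set (Fin n → RingE)) : Prop :=
  spanE X ∪ spanF X = D

/-- The rank of a (free) code: the minimum cardinality of a generating set. -/
noncomputable def genRank {n : ℕ} (D : Set (Fin n → RingE)) : ℕ :=
  sInf {m | ∃ X : Finset (Fin n → RingE), X.card = m ∧ IsGenSet X D}

/-- Prepending two coordinates to a vector of length `n`. -/
def cons2 {n : ℕ} (a b : RingE) (x : Fin n → RingE) : Fin (n + 2) → RingE :=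
  Fin.cons a (Fin.cons b x)

end ECode

namespace ECode

/-- The `ζ`-coordinates of a vector of `Eⁿ`. -/
def sndVec {n : ℕ} (x : Fin n → RingE) : Fin n → ZMod 2 := fun i => Prod.snd (x i)

/-- The first coordinate as an additive map. -/
def fstHom : RingE →+ ZMod 2 where
  toFun a := Prod.fst a
  map_zero' := rfl
  map_add' _ _ := rfl

/-- The second coordinate as an additive map. -/
def sndHom : RingE →+ ZMod 2 where
  toFun a := Prod.snd a
  map_zero' := rfl
  map_add' _ _ := rfl

theorem ringE_ext {a b : RingE} (h1 : fstHom a = fstHom b) (h2 : sndHom a = sndHom b) : a = b :=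
  Prod.ext h1 h2

theorem fst_Einner {n : ℕ} (w z : Fin n → RingE) :
    fstHom (Einner w z) = Finner (piVec w) (piVec z) :=
  map_sum fstHom _ _

theorem snd_Einner {n : ℕ} (w z : Fin n → RingE) :
    sndHom (Einner w z) = Finner (sndVec w) (piVec z) :=
  map_sum sndHom _ _

theorem Einner_eq_zero {n : ℕ} (w z : Fin n → RingE) :
    Einner w z = 0 ↔ Finner (piVec w) (piVec z) = 0 ∧ Finner (sndVec w) (piVec z) = 0 := by
  rw [← fst_Einner, ← snd_Einner]
  constructor
  · intro h
    rw [h]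
    simp
  · rintro ⟨h1, h2⟩
    exact ringE_ext (by rw [h1, map_zero]) (by rw [h2, map_zero])

theorem Finner_comm {n : ℕ} (w z : Fin n → ZMod 2) : Finner w z = Finner z w := by
  simp [Finner, mul_comm]

theorem zero_Finner {n : ℕ} (z : Fin n → ZMod 2) : Finner 0 z = 0 := by
  simp [Finner]

theorem Finner_zero {n : ℕ} (z : Fin n → ZMod 2) : Finner z 0 = 0 := by
  simp [Finner]

theorem Finner_single {n : ℕ} (w : Fin n → ZMod 2) (i : Fin n) :
    Finner w (Pi.single i 1) = w i := by
  simp [Finner, Pi.single_apply]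

theorem piVec_zeta {n : ℕ} (v : Fin n → ZMod 2) : piVec (zetaVec v) = 0 := rfl
theorem sndVec_zeta {n : ℕ} (v : Fin n → ZMod 2) : sndVec (zetaVec v) = v := rfl
theorem piVec_kappa {n : ℕ} (v : Fin n → ZMod 2) : piVec (kappaVec v) = v := rfl
theorem sndVec_kappa {n : ℕ} (v : Fin n → ZMod 2) : sndVec (kappaVec v) = 0 := rfl

theorem kappa_mem {n : ℕ} {C : Set (Fin n → RingE)} (hC : IsECode C) {x : Fin n → RingE}
    (hx : x ∈ C) : kappaVec (piVec x) ∈ C := by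
  have h := hC.2.2.2 RingE.kappa x hx
  convert h using 1
  funext i
  exact Prod.ext (one_mul _).symm (zero_mul _).symm

theorem zeta_mem {n : ℕ} {C : Set (Fin n → RingE)} (hC : IsECode C) {x : Fin n → RingE}
    (hx : x ∈ C) : zetaVec (piVec x) ∈ C := by
  have h := hC.2.2.2 RingE.zeta x hx
  convert h using 1
  funext i
  exact Prod.ext (zero_mul _).symm (one_mul _).symm

theorem res_sub_tor {n : ℕ} {C : Set (Fin n → RingE)} (hC : IsECode C) : Res C ⊆ Tor C := by
  rintro _ ⟨x, hx, rfl⟩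
  exact zeta_mem hC hx

theorem snd_mem {n : ℕ} {C : Set (Fin n → RingE)} (hC : IsECode C) {x : Fin n → RingE}
    (hx : x ∈ C) : sndVec x ∈ Tor C := by
  have h := hC.2.1 x hx _ (hC.2.2.1 _ (kappa_mem hC hx))
  show zetaVec (sndVec x) ∈ C
  convert h using 1
  funext i
  refine Prod.ext (add_neg_cancel _).symm ?_
  show Prod.snd (x i) = Prod.snd (x i) + -(0 : ZMod 2)
  simp

theorem mem_dualL {n : ℕ} {C : Set (Fin n → RingE)} (z : Fin n → RingE) :
    z ∈ dualL C ↔ piVec z ∈ dualF (Res C) ∧ sndVec z ∈ dualF (Res C) := by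
  simp only [dualL, dualF, Res, Set.mem_setOf_eq, Einner_eq_zero, Set.forall_mem_image]
  constructor
  · intro h
    exact ⟨fun w hw => by rw [Finner_comm]; exact (h w hw).1,
      fun w hw => by rw [Finner_comm]; exact (h w hw).2⟩
  · rintro ⟨h1, h2⟩ w hw
    exact ⟨by rw [Finner_comm]; exact h1 hw, by rw [Finner_comm]; exact h2 hw⟩

theorem mem_dualR {n : ℕ} {C : Set (Fin n → RingE)} (hC : IsECode C) (z : Fin n → RingE) :
    z ∈ dualR C ↔ piVec z ∈ dualF (Tor C) := by
  simp only [dualR, dualF, Set.mem_setOf_eq, Einner_eq_zero]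
  constructor
  · intro h v hv
    exact (h (zetaVec v) hv).2
  · intro h w hw
    exact ⟨h _ (res_sub_tor hC ⟨w, hw, rfl⟩), h _ (snd_mem hC hw)⟩

theorem zero_mem_dualF {n : ℕ} (B : Set (Fin n → ZMod 2)) : (0 : Fin n → ZMod 2) ∈ dualF B :=
  fun w _ => Finner_zero w

theorem res_dualL {n : ℕ} (C : Set (Fin n → RingE)) : Res (dualL C) = dualF (Res C) := by
  ext v
  constructor
  · rintro ⟨z, hz, rfl⟩
    exact ((mem_dualL z).1 hz).1
  · intro hv
    exact ⟨kappaVec v, (mem_dualL _).2 ⟨hv, zero_mem_dualF _⟩, rfl⟩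

theorem tor_dualL {n : ℕ} (C : Set (Fin n → RingE)) : Tor (dualL C) = dualF (Res C) := by
  ext v
  exact (mem_dualL _).trans ⟨fun h => h.2, fun h => ⟨zero_mem_dualF _, h⟩⟩

theorem res_dualE {n : ℕ} {C : Set (Fin n → RingE)} (hC : IsECode C) :
    Res (dualE C) = dualF (Tor C) := by
  ext v
  constructor
  · rintro ⟨z, hz, rfl⟩
    exact (mem_dualR hC z).1 hz.2
  · intro hv
    exact ⟨kappaVec v, ⟨(mem_dualL _).2 ⟨fun w hw => hv w (res_sub_tor hC hw), zero_mem_dualF _⟩,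
      (mem_dualR hC _).2 hv⟩, rfl⟩

theorem tor_dualE {n : ℕ} {C : Set (Fin n → RingE)} (hC : IsECode C) :
    Tor (dualE C) = dualF (Res C) := by
  ext v
  constructor
  · intro h
    exact ((mem_dualL _).1 h.1).2
  · intro hv
    exact ⟨(mem_dualL _).2 ⟨zero_mem_dualF _, hv⟩, (mem_dualR hC _).2 (zero_mem_dualF _)⟩

/-- The residue code as an `F₂`-subspace. -/
def resSubmodule {n : ℕ} {C : Set (Fin n → RingE)} (hC : IsECode C) :
    Submodule (ZMod 2) (Fin n → ZMod 2) :=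
  AddSubgroup.toZModSubmodule 2
    { carrier := Res C
      zero_mem' := ⟨0, hC.1, rfl⟩
      add_mem' := by
        rintro _ _ ⟨x, hx, rfl⟩ ⟨y, hy, rfl⟩
        exact ⟨x + y, hC.2.1 x hx y hy, rfl⟩
      neg_mem' := by
        rintro _ ⟨x, hx, rfl⟩
        exact ⟨-x, hC.2.2.1 x hx, rfl⟩ }

theorem mem_of_dual {n : ℕ} {C : Set (Fin n → RingE)} (hC : IsECode C) {v : Fin n → ZMod 2}
    (hv : ∀ z ∈ dualF (Res C), Finner v z = 0) : v ∈ Res C := by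
  by_contra hn
  have hn' : v ∉ resSubmodule hC := hn
  obtain ⟨f, hf, hk⟩ := Submodule.exists_le_ker_of_notMem hn'
  have key : ∀ w, Finner w (fun i => f (Pi.single i 1)) = f w := by
    intro w
    rw [LinearMap.pi_apply_eq_sum_univ f w]
    simp only [Finner, smul_eq_mul]
    refine Finset.sum_congr rfl fun i _ => ?_
    congr 2
    funext j
    simp [Pi.single_apply, eq_comm]
  apply hf
  rw [← key]
  refine hv _ fun w hw => ?_
  rw [key]
  exact hk (show w ∈ resSubmodule hC from hw)

end ECode

open ECode in
/-- The left dual is always free; the right dual of a nonzero code is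
never free; the dual is free iff the code is free. -/
theorem freeness_of_duals {n : ℕ} (C : Set (Fin n → RingE)) (hC : IsECode C) :
    IsFree (dualL C) ∧ (C ≠ {0} → ¬ IsFree (dualR C)) ∧ (IsFree (dualE C) ↔ IsFree C) := by
  refine ⟨(res_dualL C).trans (tor_dualL C).symm, ?_, ?_⟩
  · intro hne hfree
    apply hne
    have htop : ∀ v, v ∈ dualF (Tor C) := by
      intro v
      have h1 : v ∈ Tor (dualR C) := (mem_dualR hC _).2 (zero_mem_dualF _)
      have h2 : v ∈ Res (dualR C) := by
        rw [show Res (dualR C) = Tor (dualR C) from hfree]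
        exact h1
      obtain ⟨z, hz, rfl⟩ := h2
      exact (mem_dualR hC z).1 hz
    have h0 : ∀ w ∈ Tor C, w = 0 := by
      intro w hw
      funext i
      have h := htop (Pi.single i 1) w hw
      rwa [Finner_single] at h
    refine Set.eq_singleton_iff_unique_mem.2 ⟨hC.1, fun x hx => ?_⟩
    funext i
    exact Prod.ext (congrFun (h0 _ (res_sub_tor hC ⟨x, hx, rfl⟩)) i)
      (congrFun (h0 _ (snd_mem hC hx)) i)
  · unfold IsFree
    rw [res_dualE hC, tor_dualE hC]
    constructor
    · intro h
      refine (res_sub_tor hC).antisymm fun v hv => mem_of_dual hC fun z hz => ?_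
      rw [← h] at hz
      exact hz v hv
    · intro h
      rw [h]
end

section
/- For every E-linear code C of length n, Hull(C) = Hull(C^⊥), i.e. C ∩ C^⊥ = C^⊥ ∩ (C^⊥)^⊥. -/
open scoped BigOperators

namespace ECode

theorem einner_zero_iff {n : ℕ} (w z : Fin n → RingE) :
    Einner w z = 0 ↔ (∑ i, (w i).1 * (z i).1 = 0) ∧ (∑ i, (w i).2 * (z i).1 = 0) := by
  have h1 : (Einner w z).1 = ∑ i, (w i).1 * (z i).1 :=
    map_sum (AddMonoidHom.fst (ZMod 2) (ZMod 2)) (fun i => w i * z i) Finset.univ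
  have h2 : (Einner w z).2 = ∑ i, (w i).2 * (z i).1 :=
    map_sum (AddMonoidHom.snd (ZMod 2) (ZMod 2)) (fun i => w i * z i) Finset.univ
  rw [← h1, ← h2]
  exact Prod.ext_iff

theorem exists_separating {n : ℕ} (S : Set (Fin n → ZMod 2)) (h0 : 0 ∈ S)
    (hadd : ∀ x ∈ S, ∀ y ∈ S, x + y ∈ S) (x : Fin n → ZMod 2) (hx : x ∉ S) :
    ∃ a : Fin n → ZMod 2, (∀ s ∈ S, ∑ i, a i * s i = 0) ∧ ∑ i, a i * x i ≠ 0 := by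
  let p : Submodule (ZMod 2) (Fin n → ZMod 2) :=
    { carrier := S
      zero_mem' := h0
      add_mem' := fun {a b} ha hb => hadd a ha b hb
      smul_mem' := by
        intro c y hy
        have hc : c = 0 ∨ c = 1 := by revert c; decide
        rcases hc with rfl | rfl
        · simpa using h0
        · simpa using hy }
  have hxp : x ∉ p := hx
  obtain ⟨f, hf, hfp⟩ := Submodule.exists_le_ker_of_notMem hxp
  have key : ∀ y : Fin n → ZMod 2, ∑ i, f (Pi.single i 1) * y i = f y := by
    intro y
    rw [LinearMap.pi_apply_eq_sum_univ f y]
    refine Finset.sum_congr rfl fun i _ => ?_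
    rw [smul_eq_mul, mul_comm]
    congr 2
    funext j
    simp [Pi.single_apply, eq_comm]
  refine ⟨fun i => f (Pi.single i 1), fun s hs => ?_, ?_⟩
  · rw [key]
    exact hfp (show s ∈ p from hs)
  · rw [key]
    exact hf

theorem kappa_res_mem {n : ℕ} {C : Set (Fin n → RingE)} (hC : IsECode C)
    {x : Fin n → RingE} (hx : x ∈ C) : kappaVec (fun i => (x i).1) ∈ C := by
  have h := hC.2.2.2 RingE.kappa x hx
  convert h using 1
  funext i
  refine Prod.ext ?_ ?_
  · exact (one_mul _).symm
  · exact (zero_mul _).symm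

theorem zeta_res_mem {n : ℕ} {C : Set (Fin n → RingE)} (hC : IsECode C)
    {x : Fin n → RingE} (hx : x ∈ C) : zetaVec (fun i => (x i).1) ∈ C := by
  have h := hC.2.2.2 RingE.zeta x hx
  convert h using 1
  funext i
  refine Prod.ext ?_ ?_
  · exact (zero_mul _).symm
  · exact (one_mul _).symm

theorem zeta_snd_mem {n : ℕ} {C : Set (Fin n → RingE)} (hC : IsECode C)
    {x : Fin n → RingE} (hx : x ∈ C) : zetaVec (fun i => (x i).2) ∈ C := by
  have h := hC.2.1 x hx _ (hC.2.2.1 _ (kappa_res_mem hC hx))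
  convert h using 1
  funext i
  refine Prod.ext ?_ ?_
  · exact (add_neg_cancel (x i).1).symm
  · show (x i).2 = (x i).2 + -0
    simp

theorem dual_dual {n : ℕ} (C : Set (Fin n → RingE)) (hC : IsECode C) :
    dualE (dualE C) = C := by
  apply Set.Subset.antisymm
  · intro x hx
    have hk : kappaVec (fun i => (x i).1) ∈ C := by
      by_contra hn
      obtain ⟨a, ha, hax⟩ := exists_separating {r | kappaVec r ∈ C} hC.1
        (fun y hy z hz => by
          have h := hC.2.1 _ hy _ hz
          show kappaVec (y + z) ∈ C
          convert h using 1
          funext i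
          exact Prod.ext rfl (add_zero (0 : ZMod 2)).symm) _ hn
      have hm : zetaVec a ∈ dualE C := by
        refine ⟨fun w hw => ?_, fun w hw => ?_⟩
        · rw [einner_zero_iff]
          refine ⟨?_, ha _ (kappa_res_mem hC hw)⟩
          exact Finset.sum_eq_zero fun i _ => zero_mul _
        · rw [einner_zero_iff]
          exact ⟨Finset.sum_eq_zero fun i _ => mul_zero _,
            Finset.sum_eq_zero fun i _ => mul_zero _⟩
      exact hax ((einner_zero_iff _ _).1 (hx.2 _ hm)).2
    have hz : zetaVec (fun i => (x i).2) ∈ C := by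
      by_contra hn
      obtain ⟨a, ha, hax⟩ := exists_separating {r | zetaVec r ∈ C} hC.1
        (fun y hy z hz => by
          have h := hC.2.1 _ hy _ hz
          show zetaVec (y + z) ∈ C
          convert h using 1
          funext i
          exact Prod.ext (add_zero (0 : ZMod 2)).symm rfl) _ hn
      have hm : kappaVec a ∈ dualE C := by
        refine ⟨fun w hw => ?_, fun w hw => ?_⟩
        · rw [einner_zero_iff]
          refine ⟨ha _ (zeta_res_mem hC hw), ?_⟩
          exact Finset.sum_eq_zero fun i _ => zero_mul _
        · rw [einner_zero_iff]
          refine ⟨?_, ?_⟩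
          · rw [← ha _ (zeta_res_mem hC hw)]
            exact Finset.sum_congr rfl fun i _ => mul_comm _ _
          · rw [← ha _ (zeta_snd_mem hC hw)]
            exact Finset.sum_congr rfl fun i _ => mul_comm _ _
      apply hax
      rw [← ((einner_zero_iff _ _).1 (hx.1 _ hm)).2]
      exact Finset.sum_congr rfl fun i _ => mul_comm _ _
    have h := hC.2.1 _ hk _ hz
    convert h using 1
    funext i
    refine Prod.ext ?_ ?_
    · exact (add_zero (x i).1).symm
    · exact (zero_add (x i).2).symm
  · intro x hx
    exact ⟨fun w hw => hw.2 x hx, fun w hw => hw.1 x hx⟩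

end ECode

open ECode in
/-- For every `E`-linear code `C`, `Hull(C) = Hull(C^⊥)`, i.e.
`C ∩ C^⊥ = C^⊥ ∩ (C^⊥)^⊥`. -/
theorem hull_eq_hull_dual {n : ℕ} (C : Set (Fin n → RingE)) (hC : IsECode C) :
    C ∩ dualE C = dualE C ∩ dualE (dualE C) := by
  rw [dual_dual C hC, Set.inter_comm]
end
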